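/- arXiv:1101.5144 — 4 statements merged into one kernel-verified Lean document; each statement's English description precedes it below -/
import Mathlib

section
/- Let N ≥ 1, M > 0 real, τ ∈ ℝ with 1+τ ≠ 0, and λ₁,…,λ_N ∈ ℝ. Let Λ = diag(λ₁,…,λ_N), let Σ_d = diag(1,…,1,1+τ), and let μ be the Haar probability measure on O(N). Then ∫_{O(N)} exp(−(M/2)·tr(Σ_d^{-1}·g·Λ·gᵀ)) dμ(g) = exp(−(M/2)·Σ_{j=1}^N λ_j) · ∫_{S^{N-1}} exp((τM/(2(1+τ)))·Σ_{j=1}^N λ_j x_j²) dσ(x), where σ is the uniform probability measure on the unit sphere S^{N-1} ⊆ ℝ^N. -/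
open MeasureTheory Matrix

instance {n : ℕ} {α : Type*} [MeasurableSpace α] :
    MeasurableSpace (Matrix (Fin n) (Fin n) α) :=
  inferInstanceAs (MeasurableSpace (Fin n → Fin n → α))

/-- The orthogonal group acts transitively on unit vectors; the witness is a Householder
reflection. -/
lemma exists_orthogonal_transpose_mulVec_eq {n : ℕ} {x y : Fin n → ℝ}
    (hx : x ⬝ᵥ x = 1) (hy : y ⬝ᵥ y = 1) :
    ∃ k : Matrix.orthogonalGroup (Fin n) ℝ,
      (k : Matrix (Fin n) (Fin n) ℝ)ᵀ *ᵥ y = x := by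
  by_cases hxy : x = y
  · exact ⟨1, by simp [hxy]⟩
  set v : Fin n → ℝ := x - y with hv
  have hvv : v ⬝ᵥ v ≠ 0 := fun h => hxy (sub_eq_zero.mp (dotProduct_self_eq_zero.mp h))
  have hvv_expand : v ⬝ᵥ v = 2 - 2 * (x ⬝ᵥ y) := by
    simp only [hv, sub_dotProduct, dotProduct_sub, hx, hy, dotProduct_comm y x]
    ring
  have hvy : v ⬝ᵥ y = -(v ⬝ᵥ v) / 2 := by
    rw [hvv_expand, hv, sub_dotProduct, hy]
    ring
  set c : ℝ := 2 / (v ⬝ᵥ v) with hc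
  set H : Matrix (Fin n) (Fin n) ℝ := 1 - c • vecMulVec v v with hH
  have hHt : Hᵀ = H := by
    simp [hH, transpose_vecMulVec]
  have hsq : vecMulVec v v * vecMulVec v v = (v ⬝ᵥ v) • vecMulVec v v := by
    ext i j
    simp [vecMulVec_mul_vecMulVec, vecMulVec_apply]
    ring
  have hHH : H * H = 1 := by
    have hcc : c * c * (v ⬝ᵥ v) = 2 * c := by
      rw [hc]
      field_simp
    have expand : H * H
        = 1 - (2 * c) • vecMulVec v v + (c * c * (v ⬝ᵥ v)) • vecMulVec v v := by
      simp only [hH, sub_mul, mul_sub, one_mul, mul_one, smul_mul_smul_comm, hsq, smul_smul]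
      module
    rw [expand, hcc, sub_add_cancel]
  refine ⟨⟨H, (Matrix.mem_orthogonalGroup_iff (Fin n) ℝ).mpr ?_⟩, ?_⟩
  · rw [hHt, hHH]
  · change Hᵀ *ᵥ y = x
    have hcoef : c * (v ⬝ᵥ y) = -1 := by
      rw [hvy, hc]
      field_simp
    rw [hHt, hH, sub_mulVec, one_mulVec, smul_mulVec, vecMulVec_mulVec]
    rw [op_smul_eq_smul, smul_smul, hcoef, hv]
    module

lemma measurable_orthogonalGroup_mul_left {n : ℕ} (k : Matrix.orthogonalGroup (Fin n) ℝ) :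
    Measurable fun h : Matrix.orthogonalGroup (Fin n) ℝ => k * h := by
  refine Measurable.subtype_mk (measurable_pi_lambda _ fun i => measurable_pi_lambda _ fun j => ?_)
  simp only [Matrix.mul_apply]
  refine Finset.measurable_fun_sum _ fun l _ => Measurable.const_mul ?_ _
  exact (measurable_pi_apply j).comp ((measurable_pi_apply l).comp measurable_subtype_coe)

lemma measurable_orthogonalGroup_transpose_mulVec {n : ℕ} :
    Measurable fun p : Matrix.orthogonalGroup (Fin n) ℝ × (Fin n → ℝ) =>
      (p.1 : Matrix (Fin n) (Fin n) ℝ)ᵀ *ᵥ p.2 := by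
  refine measurable_pi_lambda _ fun i => ?_
  simp only [Matrix.mulVec, dotProduct, Matrix.transpose_apply]
  refine Finset.measurable_fun_sum _ fun l _ => Measurable.mul ?_ ?_
  · exact (measurable_pi_apply i).comp
      ((measurable_pi_apply l).comp (measurable_subtype_coe.comp measurable_fst))
  · exact (measurable_pi_apply l).comp measurable_snd

/-- If `g` is distributed according to a left-invariant probability measure on the orthogonal
group and `e` is a unit vector, then `gᵀ e` is uniformly distributed on the sphere. -/
lemma lintegral_orthogonalGroup_transpose_mulVec {n : ℕ}
    (μ : Measure (Matrix.orthogonalGroup (Fin n) ℝ)) [IsProbabilityMeasure μ]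
    (hμ : ∀ g : Matrix.orthogonalGroup (Fin n) ℝ, Measure.map (fun h => g * h) μ = μ)
    (σ : Measure (Fin n → ℝ)) [IsProbabilityMeasure σ]
    (hσ_sphere : ∀ᵐ x ∂σ, x ⬝ᵥ x = 1)
    (hσ_inv : ∀ g : Matrix.orthogonalGroup (Fin n) ℝ,
      Measure.map (fun x => (g : Matrix (Fin n) (Fin n) ℝ) *ᵥ x) σ = σ)
    {e : Fin n → ℝ} (he : e ⬝ᵥ e = 1) {F : (Fin n → ℝ) → ENNReal} (hF : Measurable F) :
    ∫⁻ g, F ((g : Matrix (Fin n) (Fin n) ℝ)ᵀ *ᵥ e) ∂μ = ∫⁻ x, F x ∂σ := by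
  have meas : Measurable fun p : Matrix.orthogonalGroup (Fin n) ℝ × (Fin n → ℝ) =>
      F ((p.1 : Matrix (Fin n) (Fin n) ℝ)ᵀ *ᵥ p.2) :=
    hF.comp measurable_orthogonalGroup_transpose_mulVec
  have sphere_side (g : Matrix.orthogonalGroup (Fin n) ℝ) :
      ∫⁻ x, F ((g : Matrix (Fin n) (Fin n) ℝ)ᵀ *ᵥ x) ∂σ = ∫⁻ x, F x ∂σ := by
    conv_rhs => rw [← hσ_inv (star g)]
    rw [lintegral_map hF]
    · rfl
    · exact measurable_orthogonalGroup_transpose_mulVec.comp measurable_prodMk_left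
  have group_side {x : Fin n → ℝ} (hx : x ⬝ᵥ x = 1) :
      ∫⁻ g, F ((g : Matrix (Fin n) (Fin n) ℝ)ᵀ *ᵥ x) ∂μ
        = ∫⁻ g, F ((g : Matrix (Fin n) (Fin n) ℝ)ᵀ *ᵥ e) ∂μ := by
    obtain ⟨k, rfl⟩ := exists_orthogonal_transpose_mulVec_eq hx he
    conv_rhs => rw [← hμ k]
    rw [lintegral_map (f := fun g : Matrix.orthogonalGroup (Fin n) ℝ =>
        F ((g : Matrix (Fin n) (Fin n) ℝ)ᵀ *ᵥ e)) (meas.comp measurable_prodMk_right)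
      (measurable_orthogonalGroup_mul_left k)]
    simp [Matrix.mulVec_mulVec, Matrix.transpose_mul]
  calc ∫⁻ g, F ((g : Matrix (Fin n) (Fin n) ℝ)ᵀ *ᵥ e) ∂μ
      = ∫⁻ _x, ∫⁻ g, F ((g : Matrix (Fin n) (Fin n) ℝ)ᵀ *ᵥ e) ∂μ ∂σ := by simp
    _ = ∫⁻ x, ∫⁻ g, F ((g : Matrix (Fin n) (Fin n) ℝ)ᵀ *ᵥ x) ∂μ ∂σ :=
        lintegral_congr_ae (hσ_sphere.mono fun x hx => (group_side hx).symm)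
    _ = ∫⁻ g, ∫⁻ x, F ((g : Matrix (Fin n) (Fin n) ℝ)ᵀ *ᵥ x) ∂σ ∂μ :=
        (lintegral_lintegral_swap meas.aemeasurable).symm
    _ = ∫⁻ x, F x ∂σ := by simp [sphere_side]

/-- The trace against a rank-one perturbation of the identity only sees one row of `g`. -/
lemma trace_spiked_mul_orthogonal_conj {N : ℕ} (a : ℝ) (lam : Fin (N + 1) → ℝ)
    (g : Matrix.orthogonalGroup (Fin (N + 1)) ℝ) :
    Matrix.trace (Matrix.diagonal (fun i => if i = Fin.last N then a else 1) *
        ((g : Matrix (Fin (N + 1)) (Fin (N + 1)) ℝ) * Matrix.diagonal lam *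
          (g : Matrix (Fin (N + 1)) (Fin (N + 1)) ℝ)ᵀ))
      = ∑ j, lam j + (a - 1) * ∑ j, lam j *
          ((g : Matrix (Fin (N + 1)) (Fin (N + 1)) ℝ)ᵀ *ᵥ Pi.single (Fin.last N) 1) j ^ 2 := by
  set G : Matrix (Fin (N + 1)) (Fin (N + 1)) ℝ := g.1
  have hGG : Gᵀ * G = 1 := (Matrix.mem_orthogonalGroup_iff' (Fin (N + 1)) ℝ).mp g.2
  have hdiag : Matrix.diagonal (fun i => if i = Fin.last N then a else 1)
      = 1 + Matrix.diagonal (Pi.single (Fin.last N) (a - 1)) := by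
    rw [← Matrix.diagonal_one, Matrix.diagonal_add]
    congr 1
    ext i
    by_cases h : i = Fin.last N
    · subst h
      simp
    · simp [h]
  rw [hdiag, add_mul, one_mul, Matrix.trace_add]
  congr 1
  · rw [Matrix.trace_mul_comm, ← Matrix.mul_assoc, hGG, one_mul, Matrix.trace_diagonal]
  · rw [Matrix.trace, Finset.sum_eq_single (Fin.last N)]
    · rw [Matrix.diag_apply, Matrix.diagonal_mul, Pi.single_eq_same, Matrix.mul_apply]
      simp only [Matrix.mul_diagonal, Matrix.transpose_apply, Matrix.mulVec_single_one,
        Matrix.col_apply]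
      congr 1
      exact Finset.sum_congr rfl fun j _ => by ring
    · intro i _ hi
      simp [Matrix.diagonal_mul, hi]
    · simp

/-- With `μ` the Haar probability measure on `O(N)` (left-invariant
Borel probability measure) and `σ` the uniform probability measure on the unit sphere
`S^{N-1} ⊆ ℝ^N` (rotation-invariant Borel probability measure carried by the sphere),
for `M > 0`, `τ ∈ ℝ` with `1 + τ ≠ 0`, `Λ = diag(λ₁,…,λ_N)` and
`Σ_d = diag(1,…,1,1+τ)` one has
`∫_{O(N)} exp(−(M/2)·tr(Σ_d⁻¹ g Λ gᵀ)) dμ(g)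
  = exp(−(M/2)·Σ λ_j) · ∫_{S^{N-1}} exp((τM/(2(1+τ)))·Σ λ_j x_j²) dσ(x)`.
Here the dimension is `N + 1 ≥ 1`. -/
theorem stmt_1 (N : ℕ) (M : ℝ) (hM : 0 < M) (τ : ℝ) (hτ : 1 + τ ≠ 0)
    (lam : Fin (N + 1) → ℝ)
    (μ : Measure (Matrix.orthogonalGroup (Fin (N + 1)) ℝ)) [IsProbabilityMeasure μ]
    (hμ : ∀ g : Matrix.orthogonalGroup (Fin (N + 1)) ℝ,
      Measure.map (fun h => g * h) μ = μ)
    (σ : Measure (Fin (N + 1) → ℝ)) [IsProbabilityMeasure σ]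
    (hσ_sphere : σ {x : Fin (N + 1) → ℝ | ∑ i, x i ^ 2 = 1} = 1)
    (hσ_inv : ∀ g : Matrix.orthogonalGroup (Fin (N + 1)) ℝ,
      Measure.map (fun x => (g : Matrix (Fin (N + 1)) (Fin (N + 1)) ℝ).mulVec x) σ = σ) :
    (∫ g : Matrix.orthogonalGroup (Fin (N + 1)) ℝ,
        Real.exp (-(M / 2) * Matrix.trace
          (Matrix.diagonal (fun i => if i = Fin.last N then (1 + τ)⁻¹ else 1) *
            ((g : Matrix (Fin (N + 1)) (Fin (N + 1)) ℝ) * Matrix.diagonal lam *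
              (g : Matrix (Fin (N + 1)) (Fin (N + 1)) ℝ)ᵀ))) ∂μ)
      = Real.exp (-(M / 2) * ∑ j, lam j) *
        ∫ x : Fin (N + 1) → ℝ,
          Real.exp (τ * M / (2 * (1 + τ)) * ∑ j, lam j * x j ^ 2) ∂σ := by
  have hsphere : ∀ᵐ x ∂σ, x ⬝ᵥ x = 1 := by
    have hmeas : MeasurableSet {x : Fin (N + 1) → ℝ | ∑ i, x i ^ 2 = 1} :=
      measurableSet_eq_fun (by fun_prop) measurable_const
    filter_upwards [(mem_ae_iff_prob_eq_one hmeas).mpr hσ_sphere] with x hx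
    simpa [dotProduct, sq] using hx
  have hF : Measurable fun x : Fin (N + 1) → ℝ =>
      Real.exp (τ * M / (2 * (1 + τ)) * ∑ j, lam j * x j ^ 2) := by
    fun_prop
  have hrow : Measurable fun g : Matrix.orthogonalGroup (Fin (N + 1)) ℝ =>
      (g : Matrix (Fin (N + 1)) (Fin (N + 1)) ℝ)ᵀ *ᵥ Pi.single (Fin.last N) 1 :=
    measurable_orthogonalGroup_transpose_mulVec.comp measurable_prodMk_right
  have hexp (s : ℝ) :
      Real.exp (-(M / 2) * (∑ j, lam j + ((1 + τ)⁻¹ - 1) * s))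
        = Real.exp (-(M / 2) * ∑ j, lam j) * Real.exp (τ * M / (2 * (1 + τ)) * s) := by
    rw [← Real.exp_add]
    congr 1
    field_simp
    ring
  simp_rw [trace_spiked_mul_orthogonal_conj, hexp]
  rw [integral_const_mul]
  congr 1
  rw [integral_eq_lintegral_of_nonneg_ae (.of_forall fun _ => (Real.exp_pos _).le)
      (hF.comp hrow).aestronglyMeasurable,
    integral_eq_lintegral_of_nonneg_ae (.of_forall fun _ => (Real.exp_pos _).le)
      hF.aestronglyMeasurable,
    lintegral_orthogonalGroup_transpose_mulVec μ hμ σ hsphere hσ_inv (by simp)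
      hF.ennreal_ofReal]
end

section
/- Let N ≥ 1, let a₁,…,a_N ∈ ℝ, and let s ∈ ℝ with s > max_j a_j. Let μ be the Haar probability measure on O(N). Then ∫₀^∞ u^{N/2−1}·e^{−su} · (∫_{O(N)} exp(u·Σ_{j=1}^N a_j·(g_{Nj})²) dμ(g)) du = Γ(N/2) · ∏_{j=1}^N (s − a_j)^{−1/2}, where g_{Nj} are the entries of the N-th row of g and Γ is the Gamma function. (This is the Laplace-transform form of the contour-integral formula for the rank-one real Wishart group integral.) -/
open MeasureTheory Matrix

namespace OrthogonalGroupIntegral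

open Real

variable {n : ℕ}

lemma measurable_entry (i j : Fin n) :
    Measurable fun g : Matrix.orthogonalGroup (Fin n) ℝ => (g : Matrix (Fin n) (Fin n) ℝ) i j :=
  (measurable_pi_apply j).comp ((measurable_pi_apply i).comp measurable_subtype_coe)

lemma measurable_mul_left (k : Matrix.orthogonalGroup (Fin n) ℝ) :
    Measurable fun h : Matrix.orthogonalGroup (Fin n) ℝ => k * h := by
  refine Measurable.subtype_mk (measurable_pi_lambda _ fun i => measurable_pi_lambda _ fun j => ?_)
  change Measurable fun h : Matrix.orthogonalGroup (Fin n) ℝ =>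
    ((k : Matrix (Fin n) (Fin n) ℝ) * (h : Matrix (Fin n) (Fin n) ℝ)) i j
  simp only [Matrix.mul_apply]
  exact Finset.measurable_fun_sum _ fun l _ => (measurable_entry l j).const_mul _

lemma measurable_vecMul_prod :
    Measurable fun p : (Fin n → ℝ) × Matrix.orthogonalGroup (Fin n) ℝ =>
      p.1 ᵥ* (p.2 : Matrix (Fin n) (Fin n) ℝ) := by
  refine measurable_pi_lambda _ fun j => ?_
  simp only [Matrix.vecMul, dotProduct]
  exact Finset.measurable_fun_sum _ fun l _ =>
    ((measurable_pi_apply l).comp measurable_fst).mul ((measurable_entry l j).comp measurable_snd)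

/-- Every vector is its Euclidean norm times a prescribed row of an orthogonal matrix. -/
lemma exists_row_eq (i : Fin n) (x : EuclideanSpace ℝ (Fin n)) :
    ∃ k : Matrix.orthogonalGroup (Fin n) ℝ,
      WithLp.ofLp x = ‖x‖ • (k : Matrix (Fin n) (Fin n) ℝ) i := by
  classical
  by_cases hx : x = 0
  · exact ⟨1, by simp [hx]⟩
  have hx0 : ‖x‖ ≠ 0 := norm_ne_zero_iff.mpr hx
  have hv : Orthonormal ℝ (({i} : Set (Fin n)).domRestrict fun _ => ‖x‖⁻¹ • x) := by
    refine ⟨fun _ => ?_, fun a b hab => absurd (Subsingleton.elim a b) hab⟩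
    simp [norm_smul, hx0]
  obtain ⟨b, hb⟩ := hv.exists_orthonormalBasis_extension_of_card_eq (by simp)
  refine ⟨⟨Matrix.of fun p q => b p q, ?_⟩, ?_⟩
  · rw [Matrix.mem_orthogonalGroup_iff]
    ext p q
    have h := orthonormal_iff_ite.mp b.orthonormal q p
    rw [PiLp.inner_apply] at h
    simpa [Matrix.mul_apply, Matrix.one_apply, eq_comm] using h
  · ext j
    have h := hb i rfl
    simp [h, hx0]

lemma measurePreserving_vecMul (h : Matrix.orthogonalGroup (Fin n) ℝ) :
    MeasurePreserving (fun x : Fin n → ℝ => x ᵥ* (h : Matrix (Fin n) (Fin n) ℝ)) := by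
  have hd : |((h : Matrix (Fin n) (Fin n) ℝ)ᵀ).det| = 1 := by
    have h1 := congrArg Matrix.det ((Matrix.mem_orthogonalGroup_iff _ _).mp h.2)
    rw [Matrix.det_mul, Matrix.det_transpose, Matrix.det_one] at h1
    rw [Matrix.det_transpose, ← sq_eq_sq₀ (abs_nonneg _) zero_le_one, sq_abs, sq, h1, one_pow]
  have hd0 : ((h : Matrix (Fin n) (Fin n) ℝ)ᵀ).det ≠ 0 := by
    intro h0
    simp [h0] at hd
  have heq : (fun x : Fin n → ℝ => x ᵥ* (h : Matrix (Fin n) (Fin n) ℝ)) =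
      Matrix.toLin' (h : Matrix (Fin n) (Fin n) ℝ)ᵀ := by
    ext x : 1
    simp [Matrix.mulVec_transpose]
  rw [heq]
  refine ⟨(LinearMap.continuous_on_pi _).measurable, ?_⟩
  rw [Real.map_matrix_volume_pi_eq_smul_volume_pi hd0, abs_inv, hd]
  simp

/-- Lebesgue integrals may be averaged over the orthogonal group with any invariant probability
measure. -/
lemma integral_eq_integral_norm_smul_row (i : Fin n)
    (μ : Measure (Matrix.orthogonalGroup (Fin n) ℝ)) [IsProbabilityMeasure μ]
    (hμ : ∀ g : Matrix.orthogonalGroup (Fin n) ℝ, Measure.map (fun h => g * h) μ = μ)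
    (f : (Fin n → ℝ) → ℝ) (hfm : Measurable f) (hf : Integrable f) :
    ∫ x, f x = ∫ x : EuclideanSpace ℝ (Fin n),
      ∫ h : Matrix.orthogonalGroup (Fin n) ℝ, f (‖x‖ • (h : Matrix (Fin n) (Fin n) ℝ) i) ∂μ := by
  have hrot (F : (Fin n → ℝ) → ℝ) (hF : Measurable F) (h : Matrix.orthogonalGroup (Fin n) ℝ) :
      ∫ x, F (x ᵥ* (h : Matrix (Fin n) (Fin n) ℝ)) = ∫ x, F x := by
    have hmp := measurePreserving_vecMul h
    conv_rhs => rw [← hmp.map_eq]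
    exact (integral_map hmp.measurable.aemeasurable hF.aestronglyMeasurable).symm
  have hint : Integrable (fun p : (Fin n → ℝ) × Matrix.orthogonalGroup (Fin n) ℝ =>
      f (p.1 ᵥ* (p.2 : Matrix (Fin n) (Fin n) ℝ))) (volume.prod μ) := by
    refine (integrable_prod_iff' (hfm.comp measurable_vecMul_prod).aestronglyMeasurable).mpr
      ⟨.of_forall fun h => (measurePreserving_vecMul h).integrable_comp_of_integrable hf, ?_⟩
    exact (integrable_const (∫ x, ‖f x‖)).congr (.of_forall fun h => (hrot _ hfm.norm h).symm)
  calc ∫ x, f x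
      = ∫ h : Matrix.orthogonalGroup (Fin n) ℝ,
          (∫ x, f (x ᵥ* (h : Matrix (Fin n) (Fin n) ℝ))) ∂μ := by
        simp [hrot f hfm]
    _ = ∫ x, ∫ h : Matrix.orthogonalGroup (Fin n) ℝ,
          f (x ᵥ* (h : Matrix (Fin n) (Fin n) ℝ)) ∂μ := (integral_integral_swap hint).symm
    _ = ∫ x : EuclideanSpace ℝ (Fin n), ∫ h : Matrix.orthogonalGroup (Fin n) ℝ,
          f (WithLp.ofLp x ᵥ* (h : Matrix (Fin n) (Fin n) ℝ)) ∂μ :=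
        ((PiLp.volume_preserving_ofLp (Fin n)).integral_comp
          (MeasurableEquiv.toLp 2 (Fin n → ℝ)).symm.measurableEmbedding _).symm
    _ = _ := by
        congr 1 with x
        obtain ⟨k, hk⟩ := exists_row_eq i x
        have hrow : Measurable fun h : Matrix.orthogonalGroup (Fin n) ℝ =>
            f (‖x‖ • (h : Matrix (Fin n) (Fin n) ℝ) i) :=
          hfm.comp (measurable_pi_lambda _ fun j => (measurable_entry i j).const_mul _)
        conv_rhs => rw [← hμ k]
        rw [integral_map (measurable_mul_left k).aemeasurable hrow.aestronglyMeasurable]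
        congr 1 with h
        rw [hk, Matrix.smul_vecMul]
        rfl

lemma integrable_exp_neg_sum_sq {b : Fin n → ℝ} (hb : ∀ j, 0 < b j) :
    Integrable fun x : Fin n → ℝ => exp (-∑ j, b j * x j ^ 2) := by
  simp only [← Finset.sum_neg_distrib, exp_sum, ← neg_mul]
  exact Integrable.fintype_prod fun j => integrable_exp_neg_mul_sq (hb j)

lemma integral_exp_neg_sum_sq {b : Fin n → ℝ} (hb : ∀ j, 0 < b j) :
    ∫ x : Fin n → ℝ, exp (-∑ j, b j * x j ^ 2) = √π ^ n * ∏ j, b j ^ (-(1 : ℝ) / 2) := by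
  simp only [← Finset.sum_neg_distrib, exp_sum, ← neg_mul]
  rw [integral_fintype_prod_volume_eq_prod (fun j (y : ℝ) => exp (-b j * y ^ 2))]
  simp only [integral_gaussian]
  have h (j : Fin n) : √(π / b j) = √π * b j ^ (-(1 : ℝ) / 2) := by
    rw [sqrt_div pi_pos.le, div_eq_mul_inv, sqrt_eq_rpow (b j), ← rpow_neg (hb j).le]
    norm_num
  simp [h, Finset.prod_mul_distrib]

/-- Radial integration on Euclidean space in the variable `u = ‖x‖ ^ 2`. -/
lemma integral_fun_norm_sq (N : ℕ) (F : ℝ → ℝ) :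
    Gamma ((N + 1 : ℝ) / 2) * ∫ x : EuclideanSpace ℝ (Fin (N + 1)), F (‖x‖ ^ 2) =
      √π ^ (N + 1) * ∫ u in Set.Ioi (0 : ℝ), u ^ ((N + 1 : ℝ) / 2 - 1) * F u := by
  have hsub : ∫ u in Set.Ioi (0 : ℝ), u ^ ((N + 1 : ℝ) / 2 - 1) * F u =
      2 * ∫ r in Set.Ioi (0 : ℝ), r ^ N * F (r ^ 2) := by
    rw [← integral_comp_rpow_Ioi_of_pos (p := 2) two_pos, ← integral_const_mul]
    refine setIntegral_congr_fun measurableSet_Ioi fun r (hr : 0 < r) => ?_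
    have hpow : r ^ ((2 : ℝ) - 1) * (r ^ (2 : ℝ)) ^ ((N + 1 : ℝ) / 2 - 1) = r ^ N := by
      rw [← rpow_mul hr.le, ← rpow_add hr, ← rpow_natCast]
      congr 1
      ring
    simp only [smul_eq_mul]
    rw [← hpow, ← rpow_natCast r 2]
    push_cast
    ring
  rw [integral_fun_norm_addHaar volume fun r => F (r ^ 2), hsub, measureReal_def,
    EuclideanSpace.volume_ball]
  have hG : Gamma ((N + 1 : ℝ) / 2 + 1) = (N + 1 : ℝ) / 2 * Gamma ((N + 1 : ℝ) / 2) :=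
    Gamma_add_one (by positivity)
  have hG0 : 0 < Gamma ((N + 1 : ℝ) / 2) := Gamma_pos_of_pos (by positivity)
  simp only [finrank_euclideanSpace, Fintype.card_fin, nsmul_eq_mul, smul_eq_mul,
    Nat.add_sub_cancel, Nat.cast_add, Nat.cast_one, hG, ENNReal.ofReal_one, one_pow, one_mul]
  rw [ENNReal.toReal_ofReal (by positivity)]
  field_simp

end OrthogonalGroupIntegral

open OrthogonalGroupIntegral

/-- With `μ` the Haar probability measure on `O(N)` (left-invariant Borel
probability measure), `a₁,…,a_N ∈ ℝ` and `s > max a_j`,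
`∫₀^∞ u^{N/2−1} e^{−su} (∫_{O(N)} exp(u·Σ a_j (g_{Nj})²) dμ(g)) du
  = Γ(N/2) · ∏ (s − a_j)^{−1/2}`.
Here the dimension is `N + 1 ≥ 1` and `g_{Nj}` is the `(last, j)` entry of `g`. -/
theorem stmt_2 (N : ℕ) (a : Fin (N + 1) → ℝ) (s : ℝ) (hs : ∀ j, a j < s)
    (μ : Measure (Matrix.orthogonalGroup (Fin (N + 1)) ℝ)) [IsProbabilityMeasure μ]
    (hμ : ∀ g : Matrix.orthogonalGroup (Fin (N + 1)) ℝ,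
      Measure.map (fun h => g * h) μ = μ) :
    (∫ u in Set.Ioi (0 : ℝ),
        u ^ ((N + 1 : ℝ) / 2 - 1) * Real.exp (-s * u) *
          ∫ g : Matrix.orthogonalGroup (Fin (N + 1)) ℝ,
            Real.exp (u * ∑ j, a j *
              ((g : Matrix (Fin (N + 1)) (Fin (N + 1)) ℝ) (Fin.last N) j) ^ 2) ∂μ)
      = Real.Gamma ((N + 1 : ℝ) / 2) * ∏ j, (s - a j) ^ (-(1 : ℝ) / 2) := by
  have hb (j : Fin (N + 1)) : 0 < s - a j := sub_pos.mpr (hs j)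
  have hrow (g : Matrix.orthogonalGroup (Fin (N + 1)) ℝ) :
      ∑ j, ((g : Matrix (Fin (N + 1)) (Fin (N + 1)) ℝ) (Fin.last N) j) ^ 2 = 1 := by
    have h := congrFun (congrFun ((Matrix.mem_orthogonalGroup_iff _ _).mp g.2) (Fin.last N))
      (Fin.last N)
    simpa [Matrix.mul_apply, sq] using h
  set F : ℝ → ℝ := fun u => ∫ g : Matrix.orthogonalGroup (Fin (N + 1)) ℝ,
    Real.exp (-(u * ∑ j, (s - a j) *
      ((g : Matrix (Fin (N + 1)) (Fin (N + 1)) ℝ) (Fin.last N) j) ^ 2)) ∂μ with hF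
  have hinner (u : ℝ) : Real.exp (-s * u) * ∫ g : Matrix.orthogonalGroup (Fin (N + 1)) ℝ,
      Real.exp (u * ∑ j, a j *
        ((g : Matrix (Fin (N + 1)) (Fin (N + 1)) ℝ) (Fin.last N) j) ^ 2) ∂μ = F u := by
    rw [hF, ← integral_const_mul]
    congr 1 with g
    rw [← Real.exp_add]
    simp only [sub_mul, Finset.sum_sub_distrib, ← Finset.mul_sum, hrow g]
    ring_nf
  simp only [mul_assoc, hinner]
  have hgauss := integral_exp_neg_sum_sq hb
  rw [integral_eq_integral_norm_smul_row (Fin.last N) μ hμ _ (by fun_prop)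
    (integrable_exp_neg_sum_sq hb)] at hgauss
  have hradial := integral_fun_norm_sq N F
  have hFx (x : EuclideanSpace ℝ (Fin (N + 1))) :
      ∫ h : Matrix.orthogonalGroup (Fin (N + 1)) ℝ, Real.exp (-∑ j, (s - a j) *
        (‖x‖ • (h : Matrix (Fin (N + 1)) (Fin (N + 1)) ℝ) (Fin.last N)) j ^ 2) ∂μ =
      F (‖x‖ ^ 2) := by
    simp only [hF, Pi.smul_apply, smul_eq_mul, mul_pow, Finset.mul_sum, mul_left_comm]
  simp only [hFx] at hgauss
  rw [hgauss] at hradial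
  have hpi : √Real.pi ^ (N + 1) ≠ 0 := by positivity
  refine mul_left_cancel₀ hpi ?_
  rw [← hradial]
  ring
end

section
/- For all polynomials f and q (with complex coefficients), ⟨f, T(q)⟩₁ = ∫₀^∞ f(x)·q(x)·w₀(x) dx = ⟨f, q⟩₂. In particular, with Q_j = T(x^j) (a polynomial of degree j+2), ⟨f, Q_j⟩₁ = ⟨f, x^j⟩₂ for every j ≥ 0. -/
open MeasureTheory Polynomial Set

noncomputable section

/-- The weight `w(x) = e^{−Mx/2}·x^{(M−N−1)/2}·(t−x)^{−1/2}` on `(0,∞)`,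
using the principal branch of the complex power. -/
def wC (M N : ℕ) (t : ℂ) (x : ℝ) : ℂ :=
  Complex.exp (-(M : ℂ) * x / 2) * (x : ℂ) ^ (((((M : ℝ) - N - 1) / 2 : ℝ)) : ℂ) *
    (t - x) ^ (-(1 / 2) : ℂ)

/-- The Laguerre weight `w₀(x) = x^{M−N}·e^{−Mx}`. -/
def w0R (M N : ℕ) (x : ℝ) : ℝ := x ^ (M - N) * Real.exp (-(M : ℝ) * x)

/-- The skew product `⟨f,g⟩₁ = ∫₀^∞∫₀^∞ (1/2)·sgn(x−y)·f(x)·g(y)·w(x)·w(y) dy dx`. -/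
def skew1 (M N : ℕ) (t : ℂ) (f g : Polynomial ℂ) : ℂ :=
  ∫ x in Ioi (0 : ℝ), ∫ y in Ioi (0 : ℝ),
    ((Real.sign (x - y) : ℝ) : ℂ) / 2 * f.eval (x : ℂ) * g.eval (y : ℂ) *
      wC M N t x * wC M N t y

/-- The inner product `⟨f,g⟩₂ = ∫₀^∞ f(x)·g(x)·w₀(x) dx`. -/
def inner2C (M N : ℕ) (f g : Polynomial ℂ) : ℂ :=
  ∫ x in Ioi (0 : ℝ), f.eval (x : ℂ) * g.eval (x : ℂ) * (w0R M N x : ℂ)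

/-- `IsLag M N L` says that `L n` is the monic degree-`n` orthogonal polynomial for the
weight `w₀` (the rescaled Laguerre polynomial). -/
def IsLag (M N : ℕ) (L : ℕ → Polynomial ℂ) : Prop :=
  ∀ n, (L n).Monic ∧ (L n).natDegree = n ∧
    ∀ j, j < n → inner2C M N (L n) (Polynomial.X ^ j) = 0

/-- The operator `T(q)(x) = x(t−x)q′(x) +
[(t−2x) − (M/2)x(t−x) + ((M−N−1)/2)(t−x) + x/2]·q(x)`,
i.e. formally `T(q) = (d/dx)(q·x·(t−x)·w)/w`. -/
def Tq (M N : ℕ) (t : ℂ) (q : Polynomial ℂ) : Polynomial ℂ :=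
  Polynomial.X * (Polynomial.C t - Polynomial.X) * Polynomial.derivative q +
    ((Polynomial.C t - 2 * Polynomial.X)
        - Polynomial.C ((M : ℂ) / 2) * (Polynomial.X * (Polynomial.C t - Polynomial.X))
        + Polynomial.C (((M : ℂ) - N - 1) / 2) * (Polynomial.C t - Polynomial.X)
        + Polynomial.C (1 / 2) * Polynomial.X) * q

/-- `ε(f)(x) = ∫₀^∞ (1/2)·sgn(x−y)·f(y) dy`. -/
def epsC (f : ℝ → ℂ) (x : ℝ) : ℂ :=
  ∫ y in Ioi (0 : ℝ), ((Real.sign (x - y) : ℝ) : ℂ) / 2 * f y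

/-- The squared norm `h_{n,0} = ∫₀^∞ L_n(x)²·w₀(x) dx`. -/
def hC (M N : ℕ) (L : ℕ → Polynomial ℂ) (n : ℕ) : ℂ :=
  ∫ x in Ioi (0 : ℝ), (L n).eval (x : ℂ) ^ 2 * (w0R M N x : ℂ)

end

theorem sub_ofReal_ne_zero_of_im_ne_zero {t : ℂ} (ht : t.im ≠ 0) (x : ℝ) : t - x ≠ 0 := by
  intro h
  apply ht
  simpa using congrArg Complex.im h

theorem sub_ofReal_mem_slitPlane {t : ℂ} (ht : t.im ≠ 0) (x : ℝ) :
    t - x ∈ Complex.slitPlane := by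
  right
  simpa using ht

theorem weight_exponent_nonneg {M N : ℕ} (hNM : N < M) : 0 ≤ ((M : ℝ) - N - 1) / 2 := by
  have h : (N : ℝ) + 1 ≤ M := by exact_mod_cast hNM
  linarith

theorem hasDerivAt_wC (M N : ℕ) {t : ℂ} (ht : t.im ≠ 0) {x : ℝ} (hx : 0 < x) :
    HasDerivAt (wC M N t)
      ((-(M : ℂ) / 2 + ((M : ℂ) - N - 1) / 2 / x + 1 / 2 / (t - x)) * wC M N t x) x := by
  have hx0 : (x : ℂ) ≠ 0 := by exact_mod_cast hx.ne'
  have htx := sub_ofReal_ne_zero_of_im_ne_zero ht x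
  have hexp : HasDerivAt (fun z : ℂ => Complex.exp (-(M : ℂ) * z / 2))
      (Complex.exp (-(M : ℂ) * x / 2) * (-(M : ℂ) * 1 / 2)) (x : ℂ) :=
    (((hasDerivAt_id (x : ℂ)).const_mul (-(M : ℂ))).div_const 2).cexp
  have hpow := (hasDerivAt_id (x : ℂ)).cpow_const
    (c := (((((M : ℝ) - N - 1) / 2 : ℝ)) : ℂ)) (Complex.ofReal_mem_slitPlane.2 hx)
  have hroot := ((hasDerivAt_id (x : ℂ)).const_sub t).cpow_const
    (c := (-(1 / 2) : ℂ)) (sub_ofReal_mem_slitPlane ht x)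
  have h := ((hexp.mul hpow).mul hroot).comp_ofReal
  simp only [id] at h
  rw [Complex.cpow_sub _ _ hx0, Complex.cpow_sub _ _ htx] at h
  refine h.congr_deriv ?_
  simp only [wC, Complex.cpow_one, Pi.mul_apply]
  push_cast
  field_simp

theorem continuousOn_wC {M N : ℕ} (hNM : N < M) {t : ℂ} (ht : t.im ≠ 0) :
    ContinuousOn (wC M N t) (Ici 0) := by
  have hpow : ContinuousOn (fun x : ℝ => (x : ℂ) ^ (((((M : ℝ) - N - 1) / 2 : ℝ)) : ℂ))
      (Ici 0) := by
    refine (Complex.continuous_ofReal.comp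
      (Real.continuous_rpow_const (weight_exponent_nonneg hNM))).continuousOn.congr ?_
    intro x hx
    exact (Complex.ofReal_cpow hx _).symm
  have hroot : Continuous (fun x : ℝ => (t - x) ^ (-(1 / 2) : ℂ)) :=
    Continuous.cpow (by fun_prop) continuous_const (sub_ofReal_mem_slitPlane ht)
  have hexp : Continuous (fun x : ℝ => Complex.exp (-(M : ℂ) * x / 2)) := by fun_prop
  exact (hexp.continuousOn.mul hpow).mul hroot.continuousOn

theorem continuousOn_eval_mul_wC {M N : ℕ} (hNM : N < M) {t : ℂ} (ht : t.im ≠ 0) (p : ℂ[X]) :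
    ContinuousOn (fun x : ℝ => p.eval (x : ℂ) * wC M N t x) (Ici 0) :=
  (p.continuous.comp Complex.continuous_ofReal).continuousOn.mul (continuousOn_wC hNM ht)

theorem norm_wC_le (M N : ℕ) {t : ℂ} (ht : t.im ≠ 0) {x : ℝ} (hx : 0 < x) :
    ‖wC M N t x‖ ≤
      Real.exp (-(M : ℝ) * x / 2) * x ^ (((M : ℝ) - N - 1) / 2) * |t.im| ^ (-(1 / 2) : ℝ) := by
  have hroot : ‖(t - x) ^ (-(1 / 2) : ℂ)‖ ≤ |t.im| ^ (-(1 / 2) : ℝ) := by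
    rw [Complex.norm_cpow_of_ne_zero (sub_ofReal_ne_zero_of_im_ne_zero ht x)]
    have him : |t.im| ≤ ‖t - x‖ := by simpa using Complex.abs_im_le_norm (t - x)
    have h := Real.rpow_le_rpow_of_nonpos (abs_pos.2 ht) him
      (by norm_num : (-(1 / 2) : ℝ) ≤ 0)
    simpa using h
  rw [wC, norm_mul, norm_mul, Complex.norm_exp, ← Complex.ofReal_cpow hx.le, Complex.norm_real,
    Real.norm_of_nonneg (Real.rpow_nonneg hx.le _)]
  have hre : (-(M : ℂ) * x / 2).re = -(M : ℝ) * x / 2 := by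
    have : (-(M : ℂ) * x / 2) = ((-(M : ℝ) * x / 2 : ℝ) : ℂ) := by push_cast; ring
    rw [this, Complex.ofReal_re]
  rw [hre]
  gcongr

theorem isBigO_eval_mul_wC {M : ℕ} (N : ℕ) (hM : 0 < M) {t : ℂ} (ht : t.im ≠ 0) (p : ℂ[X]) :
    (fun x : ℝ => p.eval (x : ℂ) * wC M N t x) =O[Filter.atTop]
      fun x => Real.exp (-((M : ℝ) / 4) * x) := by
  induction p using Polynomial.induction_on' with
  | add p q hp hq =>
    simp only [eval_add, add_mul]
    exact hp.add hq
  | monomial n a =>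
    have hM4 : (0 : ℝ) < M / 4 := by positivity
    have hO := (isLittleO_rpow_exp_pos_mul_atTop (n + ((M : ℝ) - N - 1) / 2) hM4).isBigO.mul
      (Asymptotics.isBigO_refl (fun x : ℝ => Real.exp (-(M : ℝ) * x / 2)) Filter.atTop)
    refine (Asymptotics.IsBigO.of_bound (‖a‖ * |t.im| ^ (-(1 / 2) : ℝ)) ?_).trans
      (hO.congr_right fun x => ?_)
    · filter_upwards [Filter.eventually_gt_atTop 0] with x hx
      rw [eval_monomial, norm_mul, norm_mul, norm_pow, Complex.norm_real,
        Real.norm_of_nonneg hx.le, Real.norm_of_nonneg (by positivity),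
        Real.rpow_add hx, Real.rpow_natCast]
      calc _ ≤ ‖a‖ * x ^ n * (Real.exp (-(M : ℝ) * x / 2) * x ^ (((M : ℝ) - N - 1) / 2) *
            |t.im| ^ (-(1 / 2) : ℝ)) := by
            gcongr
            exact norm_wC_le M N ht hx
        _ = _ := by ring
    · rw [← Real.exp_add]
      congr 1
      ring

theorem integrableOn_eval_mul_wC {M N : ℕ} (hNM : N < M) {t : ℂ} (ht : t.im ≠ 0) (p : ℂ[X]) :
    IntegrableOn (fun x : ℝ => p.eval (x : ℂ) * wC M N t x) (Ioi 0) := by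
  have hM : 0 < M := by omega
  have hM4 : (0 : ℝ) < M / 4 := by positivity
  exact integrableOn_Ici_iff_integrableOn_Ioi (by finiteness) |>.mp <|
    ((continuousOn_eval_mul_wC hNM ht p).locallyIntegrableOn
      measurableSet_Ici).integrableOn_of_isBigO_atTop (isBigO_eval_mul_wC N hM ht p)
      ⟨Ioi 0, Filter.Ioi_mem_atTop 0, exp_neg_integrableOn_Ioi 0 hM4⟩

theorem tendsto_eval_mul_wC {M : ℕ} (N : ℕ) (hM : 0 < M) {t : ℂ} (ht : t.im ≠ 0) (p : ℂ[X]) :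
    Filter.Tendsto (fun x : ℝ => p.eval (x : ℂ) * wC M N t x) Filter.atTop (nhds 0) := by
  refine (isBigO_eval_mul_wC N hM ht p).trans_tendsto ?_
  have hM4 : (0 : ℝ) < M / 4 := by positivity
  refine Real.tendsto_exp_atBot.comp ?_
  exact Filter.tendsto_id.const_mul_atTop_of_neg (neg_neg_of_pos hM4)

/-- `T(q)·w` is the derivative of `q·x·(t−x)·w` on `(0,∞)`. -/
theorem hasDerivAt_mul_wC (M N : ℕ) {t : ℂ} (ht : t.im ≠ 0) (q : ℂ[X]) {x : ℝ} (hx : 0 < x) :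
    HasDerivAt (fun x : ℝ => (q * X * (C t - X)).eval (x : ℂ) * wC M N t x)
      ((Tq M N t q).eval (x : ℂ) * wC M N t x) x := by
  have hx0 : (x : ℂ) ≠ 0 := by exact_mod_cast hx.ne'
  have htx := sub_ofReal_ne_zero_of_im_ne_zero ht x
  have h := (((q * X * (C t - X)).hasDerivAt (x : ℂ)).comp_ofReal).mul (hasDerivAt_wC M N ht hx)
  refine h.congr_deriv ?_
  simp only [Tq, derivative_mul, derivative_X, derivative_sub, derivative_C, eval_add, eval_mul,
    eval_sub, eval_C, eval_X, eval_ofNat, eval_one, eval_zero]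
  field_simp
  ring

/-- Integrating the derivative of a function vanishing at both ends of `(0,∞)` against
`sgn(x−y)/2` recovers the function. -/
theorem integral_sign_mul_deriv {G g : ℝ → ℂ} (hcont : ContinuousOn G (Ici 0))
    (hderiv : ∀ y, 0 < y → HasDerivAt G (g y) y) (hint : IntegrableOn g (Ioi 0))
    (hzero : G 0 = 0) (hlim : Filter.Tendsto G Filter.atTop (nhds 0)) {x : ℝ} (hx : 0 < x) :
    ∫ y in Ioi (0 : ℝ), ((Real.sign (x - y) : ℝ) : ℂ) / 2 * g y = G x := by
  have hleft : ∫ y in Ioc 0 x, g y = G x := by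
    rw [← intervalIntegral.integral_of_le hx.le,
      intervalIntegral.integral_eq_sub_of_hasDerivAt_of_le hx.le (hcont.mono Icc_subset_Ici_self)
        (fun y hy => hderiv y hy.1) ?_, hzero, sub_zero]
    exact (intervalIntegrable_iff_integrableOn_Ioc_of_le hx.le).2 (hint.mono_set Ioc_subset_Ioi_self)
  have hright : ∫ y in Ioi x, g y = -G x := by
    rw [integral_Ioi_of_hasDerivAt_of_tendsto (hderiv x hx).continuousAt.continuousWithinAt
      (fun y hy => hderiv y (hx.trans hy)) (hint.mono_set (Ioi_subset_Ioi hx.le)) hlim, zero_sub]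
  have hcongr_left : EqOn (fun y => (1 / 2 : ℂ) * g y)
      (fun y => ((Real.sign (x - y) : ℝ) : ℂ) / 2 * g y) (Ioo 0 x) := by
    intro y hy
    simp [Real.sign_of_pos (sub_pos.2 hy.2)]
  have hcongr_right : EqOn (fun y => (-(1 / 2) : ℂ) * g y)
      (fun y => ((Real.sign (x - y) : ℝ) : ℂ) / 2 * g y) (Ioi x) := by
    intro y hy
    simp [Real.sign_of_neg (sub_neg.2 hy), neg_div]
  have hint_left : IntegrableOn (fun y => ((Real.sign (x - y) : ℝ) : ℂ) / 2 * g y) (Ioc 0 x) := by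
    rw [integrableOn_Ioc_iff_integrableOn_Ioo]
    exact IntegrableOn.congr_fun ((hint.mono_set Ioo_subset_Ioi_self).const_mul _) hcongr_left
      measurableSet_Ioo
  have hint_right : IntegrableOn (fun y => ((Real.sign (x - y) : ℝ) : ℂ) / 2 * g y) (Ioi x) :=
    IntegrableOn.congr_fun ((hint.mono_set (Ioi_subset_Ioi hx.le)).const_mul _) hcongr_right
      measurableSet_Ioi
  rw [← Ioc_union_Ioi_eq_Ioi hx.le,
    setIntegral_union (Ioc_disjoint_Ioi le_rfl) measurableSet_Ioi hint_left hint_right,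
    integral_Ioc_eq_integral_Ioo, ← setIntegral_congr_fun measurableSet_Ioo hcongr_left,
    ← setIntegral_congr_fun measurableSet_Ioi hcongr_right, integral_const_mul,
    integral_const_mul, ← integral_Ioc_eq_integral_Ioo, hleft, hright]
  ring

theorem mul_sub_mul_wC_sq {M N : ℕ} (hNM : N < M) {t : ℂ} (ht : t.im ≠ 0) {x : ℝ} (hx : 0 < x) :
    (x : ℂ) * (t - x) * wC M N t x ^ 2 = (w0R M N x : ℂ) := by
  have htx := sub_ofReal_ne_zero_of_im_ne_zero ht x
  have hroot : ((t - x) ^ (-(1 / 2) : ℂ)) ^ 2 = (t - x)⁻¹ := by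
    rw [← Complex.cpow_nat_mul, ← Complex.cpow_neg_one]
    norm_num
  have hpow : (x ^ (((M : ℝ) - N - 1) / 2)) ^ 2 * x = x ^ (M - N) := by
    have hsplit : ((M - N : ℕ) : ℝ) = ((M : ℝ) - N - 1) / 2 * (2 : ℕ) + 1 := by
      rw [Nat.cast_sub hNM.le]
      push_cast
      ring
    rw [← Real.rpow_natCast x (M - N), hsplit, Real.rpow_add_one hx.ne', Real.rpow_mul hx.le,
      Real.rpow_natCast]
  have hexp : Complex.exp (-(M : ℂ) * x / 2) ^ 2 = Complex.exp (-(M : ℂ) * x) := by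
    rw [← Complex.exp_nat_mul]
    congr 1
    push_cast
    ring
  rw [wC, w0R, mul_pow, mul_pow, hroot, hexp, ← Complex.ofReal_cpow hx.le, ← hpow]
  push_cast
  field_simp

theorem skew1_Tq {M N : ℕ} (hNM : N < M) {t : ℂ} (ht : t.im ≠ 0) (f q : ℂ[X]) :
    skew1 M N t f (Tq M N t q) = inner2C M N f q := by
  have hM : 0 < M := by omega
  refine setIntegral_congr_fun measurableSet_Ioi fun x (hx : 0 < x) => ?_
  have hinner := integral_sign_mul_deriv (continuousOn_eval_mul_wC hNM ht (q * X * (C t - X)))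
    (fun y hy => hasDerivAt_mul_wC M N ht q hy) (integrableOn_eval_mul_wC hNM ht (Tq M N t q))
    (by simp) (tendsto_eval_mul_wC N hM ht (q * X * (C t - X))) hx
  calc ∫ y in Ioi (0 : ℝ), ((Real.sign (x - y) : ℝ) : ℂ) / 2 * f.eval (x : ℂ) *
          (Tq M N t q).eval (y : ℂ) * wC M N t x * wC M N t y
      = ∫ y in Ioi (0 : ℝ), (f.eval (x : ℂ) * wC M N t x) *
          (((Real.sign (x - y) : ℝ) : ℂ) / 2 * ((Tq M N t q).eval (y : ℂ) * wC M N t y)) := by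
        congr 1
        ext y
        ring
    _ = f.eval (x : ℂ) * q.eval (x : ℂ) * ((x : ℂ) * (t - x) * wC M N t x ^ 2) := by
        rw [integral_const_mul, hinner]
        simp only [eval_mul, eval_sub, eval_C, eval_X]
        ring
    _ = f.eval (x : ℂ) * q.eval (x : ℂ) * (w0R M N x : ℂ) := by
        rw [mul_sub_mul_wC_sq hNM ht hx]

/-- For all polynomials `f` and `q`,
`⟨f, T(q)⟩₁ = ∫₀^∞ f(x)·q(x)·w₀(x) dx = ⟨f, q⟩₂`; in particular, with `Q_j = T(x^j)`,
`⟨f, Q_j⟩₁ = ⟨f, x^j⟩₂` for every `j ≥ 0`. -/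
theorem stmt_4 (M N : ℕ) (hN : 0 < N) (hNM : N < M) (t : ℂ) (ht : t.im ≠ 0) :
    (∀ f q : Polynomial ℂ, skew1 M N t f (Tq M N t q) = inner2C M N f q) ∧
    (∀ f : Polynomial ℂ, ∀ j : ℕ,
      skew1 M N t f (Tq M N t (Polynomial.X ^ j))
        = inner2C M N f (Polynomial.X ^ j)) := by
  exact ⟨skew1_Tq hNM ht, fun f j => skew1_Tq hNM ht f (X ^ j)⟩
end

section
/- For every integer m ≥ 2 and every polynomial P (with complex coefficients) of degree ≤ m, there exist a unique polynomial q with deg q ≤ m−2 and a unique polynomial R with deg R ≤ 1 such that P = T(q) + R. Equivalently, the linear map (q, R) ↦ T(q) + R from (polynomials of degree ≤ m−2) × (polynomials of degree ≤ 1) to polynomials of degree ≤ m is a bijection. -/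
open MeasureTheory Polynomial Set

lemma Tq_sub (M N : ℕ) (t : ℂ) (p q : Polynomial ℂ) :
    Tq M N t (p - q) = Tq M N t p - Tq M N t q := by
  simp only [Tq, derivative_sub]
  ring

lemma Tq_add (M N : ℕ) (t : ℂ) (p q : Polynomial ℂ) :
    Tq M N t (p + q) = Tq M N t p + Tq M N t q := by
  simp only [Tq, derivative_add]
  ring

lemma coeff_Tq_add_two (M N : ℕ) (t : ℂ) (q : Polynomial ℂ) (k : ℕ) :
    (Tq M N t q).coeff (k + 2) =
      (t * (k + 2) + t + ((M : ℂ) - N - 1) / 2 * t) * q.coeff (k + 2)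
        + (-(k + 1) - 2 - M / 2 * t - ((M : ℂ) - N - 1) / 2 + 1 / 2) * q.coeff (k + 1)
        + M / 2 * q.coeff k := by
  have expand : Tq M N t q =
      C t * (derivative q * X) - derivative q * X ^ 2
        + C (t + ((M : ℂ) - N - 1) / 2 * t) * q
        + C (-2 - M / 2 * t - ((M : ℂ) - N - 1) / 2 + 1 / 2) * (q * X)
        + C ((M : ℂ) / 2) * (q * X ^ 2) := by
    simp only [Tq, C_add, C_sub, C_mul, C_neg, C_ofNat]
    ring
  rw [expand]
  simp only [coeff_add, coeff_sub, coeff_C_mul, coeff_mul_X_pow,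
    show k + 2 = (k + 1) + 1 from rfl, coeff_mul_X, coeff_derivative]
  push_cast
  ring

lemma coeff_Tq_of_natDegree_le (M N : ℕ) (t : ℂ) {q : Polynomial ℂ} {n : ℕ}
    (hq : q.natDegree ≤ n) : (Tq M N t q).coeff (n + 2) = M / 2 * q.coeff n := by
  rw [coeff_Tq_add_two, coeff_eq_zero_of_natDegree_lt (by lia : q.natDegree < n + 2),
    coeff_eq_zero_of_natDegree_lt (by lia : q.natDegree < n + 1)]
  ring

lemma natDegree_Tq_le (M N : ℕ) (t : ℂ) {q : Polynomial ℂ} {n : ℕ}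
    (hq : q.natDegree ≤ n) : (Tq M N t q).natDegree ≤ n + 2 := by
  rw [natDegree_le_iff_coeff_eq_zero]
  intro k hk
  obtain ⟨j, rfl⟩ : ∃ j, k = j + 2 := ⟨k - 2, by lia⟩
  rw [coeff_Tq_of_natDegree_le M N t (by lia : q.natDegree ≤ j),
    coeff_eq_zero_of_natDegree_lt (by lia), mul_zero]

lemma eq_zero_of_natDegree_Tq_le_one {M : ℕ} (hM : M ≠ 0) (N : ℕ) (t : ℂ) {q : Polynomial ℂ}
    (h : (Tq M N t q).natDegree ≤ 1) : q = 0 := by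
  have lead := coeff_Tq_of_natDegree_le M N t (le_refl q.natDegree)
  rw [coeff_eq_zero_of_natDegree_lt (by lia)] at lead
  have hM' : (M : ℂ) / 2 ≠ 0 := by simpa using hM
  exact leadingCoeff_eq_zero.mp ((mul_eq_zero.mp lead.symm).resolve_left hM')

/-- Subtracting a suitable `Tq M N t (c X ^ n)` cancels the coefficient of `X ^ (n + 2)`. -/
lemma exists_natDegree_sub_Tq_le {M : ℕ} (hM : M ≠ 0) (N : ℕ) (t : ℂ) {n : ℕ}
    {P : Polynomial ℂ} (hP : P.natDegree ≤ n + 2) :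
    ∃ q : Polynomial ℂ, q.natDegree ≤ n ∧ (P - Tq M N t q).natDegree ≤ n + 1 := by
  have hM' : (M : ℂ) ≠ 0 := by exact_mod_cast hM
  have hq : (C (2 / M * P.coeff (n + 2)) * X ^ n : Polynomial ℂ).natDegree ≤ n :=
    natDegree_C_mul_X_pow_le _ _
  refine ⟨_, hq, ?_⟩
  rw [natDegree_le_iff_coeff_eq_zero]
  intro k hk
  rw [coeff_sub]
  rcases (show n + 2 ≤ k from hk).eq_or_lt with rfl | hk'
  · rw [coeff_Tq_of_natDegree_le M N t hq, coeff_C_mul_X_pow, if_pos rfl]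
    field_simp
    ring
  · rw [coeff_eq_zero_of_natDegree_lt (hP.trans_lt hk'),
      coeff_eq_zero_of_natDegree_lt ((natDegree_Tq_le M N t hq).trans_lt hk'), sub_zero]

lemma exists_eq_Tq_add {M : ℕ} (hM : M ≠ 0) (N : ℕ) (t : ℂ) (n : ℕ) (P : Polynomial ℂ)
    (hP : P.natDegree ≤ n + 2) :
    ∃ q R : Polynomial ℂ, q.natDegree ≤ n ∧ R.natDegree ≤ 1 ∧ P = Tq M N t q + R := by
  induction n generalizing P with
  | zero =>
    obtain ⟨q, hq, hR⟩ := exists_natDegree_sub_Tq_le hM N t hP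
    exact ⟨q, _, hq, hR, (add_sub_cancel _ _).symm⟩
  | succ n ih =>
    obtain ⟨q, hq, hR⟩ := exists_natDegree_sub_Tq_le hM N t hP
    obtain ⟨q', R, hq', hR', h⟩ := ih _ hR
    refine ⟨q + q', R, natDegree_add_le_of_degree_le hq (by lia), hR', ?_⟩
    rw [Tq_add, add_assoc, ← h, add_sub_cancel]

/-- For every `m ≥ 2` and every polynomial `P` of degree `≤ m`, there
are unique polynomials `q` of degree `≤ m−2` and `R` of degree `≤ 1` with
`P = T(q) + R`. -/
theorem stmt_5 (M N : ℕ) (hN : 0 < N) (hNM : N < M) (t : ℂ) (ht : t.im ≠ 0)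
    (m : ℕ) (hm : 2 ≤ m) (P : Polynomial ℂ) (hP : P.natDegree ≤ m) :
    ∃! qR : Polynomial ℂ × Polynomial ℂ,
      qR.1.natDegree ≤ m - 2 ∧ qR.2.natDegree ≤ 1 ∧ P = Tq M N t qR.1 + qR.2 := by
  have hM : M ≠ 0 := by lia
  obtain ⟨q, R, hq, hR, h⟩ := exists_eq_Tq_add hM N t (m - 2) P (by lia)
  refine ⟨(q, R), ⟨hq, hR, h⟩, ?_⟩
  rintro ⟨q', R'⟩ ⟨-, hR', h'⟩
  dsimp only at hR' h'
  have hT : Tq M N t (q' - q) = R - R' := by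
    rw [Tq_sub]
    linear_combination h - h'
  have hqq : q' = q := sub_eq_zero.mp <| eq_zero_of_natDegree_Tq_le_one hM N t <| by
    rw [hT]
    exact natDegree_sub_le_of_le hR hR'
  subst hqq
  exact Prod.ext rfl (add_left_cancel (h'.symm.trans h))
end
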